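/- arXiv:2303.08034 — 2 statements merged into one kernel-verified Lean document; each statement's English description precedes it below -/
import Mathlib

section
/- Let H : ℝⁿ → ℝ be differentiable with discrete gradient ∇̄H, let S(x) = sᵀx be a linear function on ℝⁿ with s ∈ ℝⁿ, let J₁,…,J_k, M₁,…,M_l ∈ ℝⁿˣⁿ be constant skew-symmetric matrices, let gⱼ, g_{Sβ} ∈ ℝⁿˣᵐ be constant matrices, let γ̂ᵢ > 0 and γ̂_{port,j} > 0 be functions, and let h > 0, u_k, τ_k ∈ ℝᵐ. Suppose x_k, x_{k+1} ∈ ℝⁿ satisfy the discrete gradient scheme (x_{k+1} − x_k)/h = Σᵢ γ̂ᵢ(x_{k+1/2}) {S,H}ᵈ_{Jᵢ} Jᵢ ∇̄H(x_k,x_{k+1}) + Σ_α M_α ∇̄H(x_k,x_{k+1}) + Σⱼ γ̂_{port,j}(x_{k+1/2},u_k) {S_tot,H_tot}ᵈ_{J_port,gⱼ} gⱼ u_k + Σ_β g_{Sβ} u_k, and define y_k = Σⱼ γ̂_{port,j}(x_{k+1/2},u_k) {S_tot,H_tot}ᵈ_{J_port,gⱼ} gⱼᵀ∇̄H(x_k,x_{k+1})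 + Σ_β g_{Sβ}ᵀ∇̄H(x_k,x_{k+1}). Then the discrete energy balance holds exactly: H(x_{k+1}) − H(x_k) − h y_kᵀ u_k = 0. -/
open Matrix

/-- A discrete gradient of a differentiable function `H : ℝⁿ → ℝ`: a continuous map
`∇̄H : ℝⁿ × ℝⁿ → ℝⁿ` with `∇̄H(x,x')ᵀ(x'−x) = H(x') − H(x)` and `∇̄H(x,x) = ∇H(x)`. -/
def IsDiscreteGradient {n : ℕ} (H : EuclideanSpace ℝ (Fin n) → ℝ)
    (DH : EuclideanSpace ℝ (Fin n) → EuclideanSpace ℝ (Fin n) → EuclideanSpace ℝ (Fin n)) :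
    Prop :=
  Continuous (fun p : EuclideanSpace ℝ (Fin n) × EuclideanSpace ℝ (Fin n) => DH p.1 p.2) ∧
  (∀ x x' : EuclideanSpace ℝ (Fin n), DH x x' ⬝ᵥ (x' - x) = H x' - H x) ∧
  (∀ x : EuclideanSpace ℝ (Fin n), DH x x = gradient H x)

/-- The quadratic form of a skew-symmetric real matrix vanishes. -/
lemma dotProduct_mulVec_self_of_transpose_eq_neg {ι : Type*} [Fintype ι] {A : Matrix ι ι ℝ}
    (hA : Aᵀ = -A) (v : ι → ℝ) : v ⬝ᵥ A *ᵥ v = 0 := by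
  have key : v ⬝ᵥ A *ᵥ v = -(v ⬝ᵥ A *ᵥ v) := by
    conv_lhs => rw [dotProduct_mulVec, ← mulVec_transpose, hA, neg_mulVec, neg_dotProduct,
      dotProduct_comm]
  linarith

/-- the discrete gradient scheme for an irreversible port-Hamiltonian system
with constant skew-symmetric structure matrices and linear entropy `S(x) = sᵀx`
(so `∇̄S = s`) satisfies the exact discrete energy balance
`H(x_{k+1}) − H(x_k) − h y_kᵀ u_k = 0`. -/
theorem discrete_iphs_energy_balance {n m k l kb lb : ℕ}
    (H : EuclideanSpace ℝ (Fin n) → ℝ) (hH : Differentiable ℝ H)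
    (DH : EuclideanSpace ℝ (Fin n) → EuclideanSpace ℝ (Fin n) → EuclideanSpace ℝ (Fin n))
    (hDH : IsDiscreteGradient H DH)
    (s : Fin n → ℝ) (S : EuclideanSpace ℝ (Fin n) → ℝ) (hSdef : ∀ z, S z = s ⬝ᵥ z)
    (J : Fin k → Matrix (Fin n) (Fin n) ℝ) (hJ : ∀ i, (J i)ᵀ = -(J i))
    (M : Fin l → Matrix (Fin n) (Fin n) ℝ) (hM : ∀ a, (M a)ᵀ = -(M a))
    (γ : Fin k → EuclideanSpace ℝ (Fin n) → ℝ) (hγ : ∀ i z, 0 < γ i z)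
    (g : Fin kb → Matrix (Fin n) (Fin m) ℝ)
    (gS : Fin lb → Matrix (Fin n) (Fin m) ℝ)
    (γp : Fin kb → EuclideanSpace ℝ (Fin n) → (Fin m → ℝ) → ℝ) (hγp : ∀ j z v, 0 < γp j z v)
    (h : ℝ) (hh : 0 < h) (u τk : Fin m → ℝ)
    (xk xk1 : EuclideanSpace ℝ (Fin n))
    (hscheme : (1 / h) • (xk1 - xk) =
      ∑ i, (γ i ((1 / 2 : ℝ) • (xk + xk1)) * (s ⬝ᵥ (J i).mulVec (DH xk xk1))) •
          (J i).mulVec (DH xk xk1)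
        + ∑ a, (M a).mulVec (DH xk xk1)
        + ∑ j, (γp j ((1 / 2 : ℝ) • (xk + xk1)) u *
            ((g j)ᵀ.mulVec s ⬝ᵥ u - τk ⬝ᵥ (g j)ᵀ.mulVec (DH xk xk1))) • (g j).mulVec u
        + ∑ b, (gS b).mulVec u)
    (y : Fin m → ℝ)
    (hy : y = ∑ j, (γp j ((1 / 2 : ℝ) • (xk + xk1)) u *
            ((g j)ᵀ.mulVec s ⬝ᵥ u - τk ⬝ᵥ (g j)ᵀ.mulVec (DH xk xk1))) •
          (g j)ᵀ.mulVec (DH xk xk1)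
        + ∑ b, (gS b)ᵀ.mulVec (DH xk xk1)) :
    H xk1 - H xk - h * (y ⬝ᵥ u) = 0 := by
  have hgrad := hDH.2.1 xk xk1
  have hdot := congrArg (fun v : Fin n → ℝ => DH xk xk1 ⬝ᵥ v) hscheme
  have hadj (A : Matrix (Fin n) (Fin m) ℝ) :
      DH xk xk1 ⬝ᵥ A *ᵥ u = Aᵀ *ᵥ DH xk xk1 ⬝ᵥ u := by
    rw [dotProduct_mulVec, mulVec_transpose]
  simp only [dotProduct_add, dotProduct_sum, dotProduct_smul, hadj,
    dotProduct_mulVec_self_of_transpose_eq_neg (hJ _),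
    dotProduct_mulVec_self_of_transpose_eq_neg (hM _), smul_zero, Finset.sum_const_zero,
    zero_add, hgrad] at hdot
  have hyu : y ⬝ᵥ u = (1 / h) • (H xk1 - H xk) := by
    rw [hdot, hy]
    simp only [add_dotProduct, sum_dotProduct, smul_dotProduct]
  rw [hyu, smul_eq_mul]
  field_simp
  ring
end

section
/- Let H : ℝⁿ → ℝ be differentiable with discrete gradient ∇̄H, let S(x) = sᵀx be linear with s ∈ ℝⁿ, let J₁,…,J_k, M₁,…,M_l ∈ ℝⁿˣⁿ be constant skew-symmetric matrices with s ∈ ker M_α for every α, let gⱼ, g_{Sβ} ∈ ℝⁿˣᵐ be constant matrices, let γ̂ᵢ and γ̂_{port,j} be strictly positive functions, and let h > 0, u_k, τ_k ∈ ℝᵐ be such that the discrete reversible port brackets vanish: (g_{Sβ}ᵀs)ᵀu_k − τ_kᵀ(g_{Sβ}ᵀ∇̄H(x_k,x_{k+1})) = 0 for all β. Suppose x_k, x_{k+1} ∈ ℝⁿ satisfy the discrete gradient scheme (x_{k+1} − x_k)/h = Σᵢ γ̂ᵢ(x_{k+1/2}) {S,H}ᵈ_{Jᵢ} Jᵢ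 ∇̄H(x_k,x_{k+1}) + Σ_α M_α ∇̄H(x_k,x_{k+1}) + Σⱼ γ̂_{port,j}(x_{k+1/2},u_k) {S_tot,H_tot}ᵈ_{J_port,gⱼ} gⱼ u_k + Σ_β g_{Sβ} u_k, with output y_k = Σⱼ γ̂_{port,j}(x_{k+1/2},u_k) {S_tot,H_tot}ᵈ_{J_port,gⱼ} gⱼᵀ∇̄H(x_k,x_{k+1}) + Σ_β g_{Sβ}ᵀ∇̄H(x_k,x_{k+1}). Then the discrete entropy balance holds: S(x_{k+1}) − S(x_k) − h y_kᵀ τ_k = h [Σᵢ γ̂ᵢ(x_{k+1/2}) ({S,H}ᵈ_{Jᵢ})² + Σⱼ γ̂_{port,j}(x_{k+1/2},u_k) ({S_tot,H_tot}ᵈ_{J_port,gⱼ})²] ≥ 0. -/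
open Matrix

/-- the discrete gradient scheme for an irreversible port-Hamiltonian
system with linear entropy `S(x) = sᵀx`, `s ∈ ker M_α`, strictly positive `γ̂ᵢ`,
`γ̂_{port,j}` and vanishing discrete reversible port brackets satisfies the discrete
entropy balance
`S(x_{k+1}) − S(x_k) − h y_kᵀτ_k = h[Σᵢ γ̂ᵢ ({S,H}ᵈ_{Jᵢ})² + Σⱼ γ̂_{port,j} ({S_tot,H_tot}ᵈ)²] ≥ 0`. -/
theorem discrete_iphs_entropy_balance {n m k l kb lb : ℕ}
    (H : EuclideanSpace ℝ (Fin n) → ℝ) (hH : Differentiable ℝ H)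
    (DH : EuclideanSpace ℝ (Fin n) → EuclideanSpace ℝ (Fin n) → EuclideanSpace ℝ (Fin n))
    (hDH : IsDiscreteGradient H DH)
    (s : Fin n → ℝ) (S : EuclideanSpace ℝ (Fin n) → ℝ) (hSdef : ∀ z, S z = s ⬝ᵥ z)
    (J : Fin k → Matrix (Fin n) (Fin n) ℝ) (hJ : ∀ i, (J i)ᵀ = -(J i))
    (M : Fin l → Matrix (Fin n) (Fin n) ℝ) (hM : ∀ a, (M a)ᵀ = -(M a))
    (hker : ∀ a, (M a).mulVec s = 0)
    (γ : Fin k → EuclideanSpace ℝ (Fin n) → ℝ) (hγ : ∀ i z, 0 < γ i z)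
    (g : Fin kb → Matrix (Fin n) (Fin m) ℝ)
    (gS : Fin lb → Matrix (Fin n) (Fin m) ℝ)
    (γp : Fin kb → EuclideanSpace ℝ (Fin n) → (Fin m → ℝ) → ℝ) (hγp : ∀ j z v, 0 < γp j z v)
    (h : ℝ) (hh : 0 < h) (u τk : Fin m → ℝ)
    (xk xk1 : EuclideanSpace ℝ (Fin n))
    (hrev : ∀ b : Fin lb, (gS b)ᵀ.mulVec s ⬝ᵥ u - τk ⬝ᵥ (gS b)ᵀ.mulVec (DH xk xk1) = 0)
    (hscheme : (1 / h) • (xk1 - xk) =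
      ∑ i, (γ i ((1 / 2 : ℝ) • (xk + xk1)) * (s ⬝ᵥ (J i).mulVec (DH xk xk1))) •
          (J i).mulVec (DH xk xk1)
        + ∑ a, (M a).mulVec (DH xk xk1)
        + ∑ j, (γp j ((1 / 2 : ℝ) • (xk + xk1)) u *
            ((g j)ᵀ.mulVec s ⬝ᵥ u - τk ⬝ᵥ (g j)ᵀ.mulVec (DH xk xk1))) • (g j).mulVec u
        + ∑ b, (gS b).mulVec u)
    (y : Fin m → ℝ)
    (hy : y = ∑ j, (γp j ((1 / 2 : ℝ) • (xk + xk1)) u *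
            ((g j)ᵀ.mulVec s ⬝ᵥ u - τk ⬝ᵥ (g j)ᵀ.mulVec (DH xk xk1))) •
          (g j)ᵀ.mulVec (DH xk xk1)
        + ∑ b, (gS b)ᵀ.mulVec (DH xk xk1)) :
    S xk1 - S xk - h * (y ⬝ᵥ τk) =
      h * (∑ i, γ i ((1 / 2 : ℝ) • (xk + xk1)) * (s ⬝ᵥ (J i).mulVec (DH xk xk1)) ^ 2
        + ∑ j, γp j ((1 / 2 : ℝ) • (xk + xk1)) u *
            ((g j)ᵀ.mulVec s ⬝ᵥ u - τk ⬝ᵥ (g j)ᵀ.mulVec (DH xk xk1)) ^ 2)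
    ∧ 0 ≤ h * (∑ i, γ i ((1 / 2 : ℝ) • (xk + xk1)) * (s ⬝ᵥ (J i).mulVec (DH xk xk1)) ^ 2
        + ∑ j, γp j ((1 / 2 : ℝ) • (xk + xk1)) u *
            ((g j)ᵀ.mulVec s ⬝ᵥ u - τk ⬝ᵥ (g j)ᵀ.mulVec (DH xk xk1)) ^ 2) := by
  have hMs : ∀ a, s ⬝ᵥ M a *ᵥ (DH xk xk1) = 0 := fun a => by
    rw [dotProduct_mulVec, ← mulVec_transpose, hM, neg_mulVec, hker, neg_zero, zero_dotProduct]
  have hadj : ∀ A : Matrix (Fin n) (Fin m) ℝ, s ⬝ᵥ A *ᵥ u = Aᵀ *ᵥ s ⬝ᵥ u := fun A => by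
    rw [dotProduct_mulVec, mulVec_transpose]
  have hrevτ : ∀ b, (gS b)ᵀ *ᵥ s ⬝ᵥ u = (gS b)ᵀ *ᵥ (DH xk xk1) ⬝ᵥ τk := fun b => by
    rw [dotProduct_comm _ τk]
    exact sub_eq_zero.mp (hrev b)
  refine ⟨?_, ?_⟩
  · have hS := congrArg (s ⬝ᵥ ·) hscheme
    simp only [dotProduct_add, dotProduct_sum, dotProduct_smul, dotProduct_sub, smul_eq_mul, hMs,
      hadj, hrevτ, Finset.sum_const_zero, add_zero] at hS
    have hincr : S xk1 - S xk = h * (1 / h * (S xk1 - S xk)) := by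
      field_simp
    rw [hincr, hSdef, hSdef, hS, hy]
    simp only [add_dotProduct, sum_dotProduct, smul_dotProduct, smul_eq_mul]
    rw [← mul_sub]
    congr 1
    rw [add_sub_add_right_eq_sub, add_sub_assoc, ← Finset.sum_sub_distrib]
    congr 1
    · exact Finset.sum_congr rfl fun i _ => by ring
    · exact Finset.sum_congr rfl fun j _ => by
        rw [dotProduct_comm _ τk]
        ring
  · exact mul_nonneg hh.le (add_nonneg
      (Finset.sum_nonneg fun i _ => mul_nonneg (hγ i _).le (sq_nonneg _))
      (Finset.sum_nonneg fun j _ => mul_nonneg (hγp j _ _).le (sq_nonneg _)))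
end
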